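/- arXiv:2102.06077 — 12 statements merged into one kernel-verified Lean document; each statement's English description precedes it below -/
import Mathlib

section
/- Let R be a commutative local ring with identity, let I be a weakly 1-absorbing prime ideal of R, and let (a, b, c) be a triple-zero of I for some nonunit elements a, b, c ∈ R. Then abI = acI = bcI = 0 and aI² = bI² = cI² = 0. -/
/-- A proper ideal `I` of a commutative ring `R` is *weakly 1-absorbing prime* if for all
nonunit elements `a, b, c` with `0 ≠ a * b * c ∈ I`, either `a * b ∈ I` or `c ∈ I`. -/
def IsWeakly1AbsorbingPrime {R : Type*} [CommRing R] (I : Ideal R) : Prop :=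
  I ≠ ⊤ ∧ ∀ a b c : R, ¬IsUnit a → ¬IsUnit b → ¬IsUnit c →
    a * b * c ≠ 0 → a * b * c ∈ I → a * b ∈ I ∨ c ∈ I

/-- A proper ideal `I` of a commutative ring `R` is *1-absorbing prime* if for all
nonunit elements `a, b, c` with `a * b * c ∈ I`, either `a * b ∈ I` or `c ∈ I`. -/
def Is1AbsorbingPrime {R : Type*} [CommRing R] (I : Ideal R) : Prop :=
  I ≠ ⊤ ∧ ∀ a b c : R, ¬IsUnit a → ¬IsUnit b → ¬IsUnit c →
    a * b * c ∈ I → a * b ∈ I ∨ c ∈ I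

/-- A proper ideal `P` of a commutative ring `R` is *weakly prime* if for all `a, b`
with `0 ≠ a * b ∈ P`, either `a ∈ P` or `b ∈ P`. -/
def IsWeaklyPrime {R : Type*} [CommRing R] (P : Ideal R) : Prop :=
  P ≠ ⊤ ∧ ∀ a b : R, a * b ≠ 0 → a * b ∈ P → a ∈ P ∨ b ∈ P

/-- A triple-zero of a weakly 1-absorbing prime ideal `I` of a local ring stays one under
translation by elements of `I`. -/
theorem IsWeakly1AbsorbingPrime.add_mul_add_mul_add_eq_zero {R : Type*} [CommRing R]
    [IsLocalRing R] {I : Ideal R} (hI : IsWeakly1AbsorbingPrime I) {a b c : R}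
    (ha : ¬IsUnit a) (hb : ¬IsUnit b) (hc : ¬IsUnit c)
    (habc : a * b * c = 0) (hab : a * b ∉ I) (hcI : c ∉ I)
    {x y z : R} (hx : x ∈ I) (hy : y ∈ I) (hz : z ∈ I) :
    (a + x) * (b + y) * (c + z) = 0 := by
  have nonunit_add {r s : R} (hr : ¬IsUnit r) (hs : s ∈ I) : ¬IsUnit (r + s) :=
    IsLocalRing.nonunits_add hr fun h => hI.1 (I.eq_top_of_isUnit_mem hs h)
  have mul_sub : (a + x) * (b + y) - a * b ∈ I := by
    have h : (a + x) * (b + y) - a * b = (b + y) * x + a * y := by ring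
    rw [h]
    exact I.add_mem (I.mul_mem_left _ hx) (I.mul_mem_left _ hy)
  by_contra hne
  have hmem : (a + x) * (b + y) * (c + z) ∈ I := by
    have h : (a + x) * (b + y) * (c + z) =
        c * ((a + x) * (b + y) - a * b) + (a + x) * (b + y) * z := by
      linear_combination habc
    rw [h]
    exact I.add_mem (I.mul_mem_left _ mul_sub) (I.mul_mem_left _ hz)
  rcases hI.2 _ _ _ (nonunit_add ha hx) (nonunit_add hb hy) (nonunit_add hc hz) hne hmem
    with h | h
  · exact hab (by simpa using I.sub_mem h mul_sub)
  · exact hcI ((I.add_mem_iff_left hz).1 h)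

/-- If `I` is a weakly 1-absorbing prime ideal of a local ring `R` and `(a, b, c)` is a
triple-zero of `I`, then `abI = acI = bcI = 0` and `aI² = bI² = cI² = 0`. -/
theorem statement1 {R : Type*} [CommRing R] [IsLocalRing R] (I : Ideal R)
    (hI : IsWeakly1AbsorbingPrime I) (a b c : R)
    (ha : ¬IsUnit a) (hb : ¬IsUnit b) (hc : ¬IsUnit c)
    (habc : a * b * c = 0) (hab : a * b ∉ I) (hcI : c ∉ I) :
    ((∀ x ∈ I, a * b * x = 0) ∧ (∀ x ∈ I, a * c * x = 0) ∧ (∀ x ∈ I, b * c * x = 0)) ∧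
    ((∀ x ∈ I, ∀ y ∈ I, a * x * y = 0) ∧ (∀ x ∈ I, ∀ y ∈ I, b * x * y = 0) ∧
      (∀ x ∈ I, ∀ y ∈ I, c * x * y = 0)) := by
  have key {x y z : R} (hx : x ∈ I) (hy : y ∈ I) (hz : z ∈ I) :
      (a + x) * (b + y) * (c + z) = 0 :=
    hI.add_mul_add_mul_add_eq_zero ha hb hc habc hab hcI hx hy hz
  have h0 : (0 : R) ∈ I := I.zero_mem
  have hab0 : ∀ x ∈ I, a * b * x = 0 := fun x hx => by
    linear_combination key h0 h0 hx - habc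
  have hac0 : ∀ x ∈ I, a * c * x = 0 := fun x hx => by
    linear_combination key h0 hx h0 - habc
  have hbc0 : ∀ x ∈ I, b * c * x = 0 := fun x hx => by
    linear_combination key hx h0 h0 - habc
  refine ⟨⟨hab0, hac0, hbc0⟩, fun x hx y hy => ?_, fun x hx y hy => ?_, fun x hx y hy => ?_⟩
  · linear_combination key h0 hx hy - habc - hab0 y hy - hac0 x hx
  · linear_combination key hx h0 hy - habc - hab0 y hy - hbc0 x hx
  · linear_combination key hx hy h0 - habc - hac0 y hy - hbc0 x hx
end

section
/- Let R be a commutative local ring with identity and let I be a weakly 1-absorbing prime ideal of R that is not a 1-absorbing prime ideal. Then I³ = 0. -/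
/-- If `I` is a weakly 1-absorbing prime ideal of a local ring `R` that is not 1-absorbing
prime, then `I³ = 0`. -/
theorem statement2 {R : Type*} [CommRing R] [IsLocalRing R] (I : Ideal R)
    (hI : IsWeakly1AbsorbingPrime I) (hI' : ¬Is1AbsorbingPrime I) :
    I ^ 3 = ⊥ := by
  have hex : ∃ a b c : R, ¬IsUnit a ∧ ¬IsUnit b ∧ ¬IsUnit c ∧ a * b * c ∈ I ∧
      a * b ∉ I ∧ c ∉ I := by
    by_contra! h
    exact hI' ⟨hI.1, fun a b c ha hb hc habc =>
      or_iff_not_imp_left.2 (h a b c ha hb hc habc)⟩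
  obtain ⟨a, b, c, ha, hb, hc, habcI, hab, hcI⟩ := hex
  have habc : a * b * c = 0 := by
    by_contra hne
    exact (hI.2 a b c ha hb hc hne habcI).elim hab hcI
  have key {x y z : R} (hx : x ∈ I) (hy : y ∈ I) (hz : z ∈ I) :
      (a + x) * (b + y) * (c + z) = 0 :=
    hI.add_mul_add_mul_add_eq_zero ha hb hc habc hab hcI hx hy hz
  rw [eq_bot_iff, pow_three', Ideal.mul_le]
  intro r hr z hz
  rw [Ideal.mem_bot]
  induction hr using Submodule.mul_induction_on' with
  | mem_mul_mem x hx y hy =>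
    have h0 := I.zero_mem
    linear_combination key hx hy hz - key hx hy h0 - key hx h0 hz - key h0 hy hz
      + key hx h0 h0 + key h0 hy h0 + key h0 h0 hz - habc
  | add r _ s _ hr hs => rw [add_mul, hr, hs, add_zero]
end

section
/- Let R be a commutative local ring with identity and let I be a weakly 1-absorbing prime ideal of R that is not a 1-absorbing prime ideal. Then the radical of I equals the nilradical of R, i.e., √I = √0. -/
/-- If `I` is a weakly 1-absorbing prime ideal of a local ring `R` that is not 1-absorbing
prime, then `√I = √0`. -/
theorem statement3 {R : Type*} [CommRing R] [IsLocalRing R] (I : Ideal R)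
    (hI : IsWeakly1AbsorbingPrime I) (hI' : ¬Is1AbsorbingPrime I) :
    I.radical = nilradical R := by
  obtain ⟨a, b, c, ha, hb, hc, habcI, hab, hcI⟩ : ∃ a b c : R, ¬IsUnit a ∧ ¬IsUnit b ∧
      ¬IsUnit c ∧ a * b * c ∈ I ∧ a * b ∉ I ∧ c ∉ I := by
    by_contra! h
    exact hI' ⟨hI.1, fun a b c ha hb hc habc =>
      or_iff_not_imp_left.2 (h a b c ha hb hc habc)⟩
  have habc : a * b * c = 0 := by
    by_contra h
    exact (hI.2 a b c ha hb hc h habcI).elim hab hcI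
  refine le_antisymm (Ideal.radical_le_radical_iff.2 fun x hx => ?_)
    (Ideal.radical_mono bot_le)
  have shift {u v w : R} (hu : u ∈ I) (hv : v ∈ I) (hw : w ∈ I) :
      (a + u) * (b + v) * (c + w) = 0 :=
    hI.add_mul_add_mul_add_eq_zero ha hb hc habc hab hcI hu hv hw
  have h0 : (0 : R) ∈ I := I.zero_mem
  refine ⟨3, (?_ : x ^ 3 = 0)⟩
  linear_combination shift hx hx hx - shift hx hx h0 - shift hx h0 hx - shift h0 hx hx +
    shift hx h0 h0 + shift h0 hx h0 + shift h0 h0 hx - habc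
end

section
/- Let R be a reduced commutative local ring with identity and let I be a nonzero proper ideal of R. Then I is a weakly 1-absorbing prime ideal of R if and only if I is a 1-absorbing prime ideal of R. -/
/-- If `R` is a reduced local ring and `I ≠ 0` is a proper ideal of `R`, then `I` is a
weakly 1-absorbing prime ideal of `R` iff `I` is a 1-absorbing prime ideal of `R`. -/
theorem statement4 {R : Type*} [CommRing R] [IsLocalRing R] [IsReduced R] (I : Ideal R)
    (hI0 : I ≠ ⊥) (hItop : I ≠ ⊤) :
    IsWeakly1AbsorbingPrime I ↔ Is1AbsorbingPrime I := by
  refine ⟨fun h => ⟨hItop, fun a b c ha hb hc habc => ?_⟩,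
    fun h => ⟨hItop, fun a b c ha hb hc _ => h.2 a b c ha hb hc⟩⟩
  by_cases h0 : a * b * c = 0
  · by_contra! hcon
    refine hI0 ((Submodule.eq_bot_iff I).2 fun x hx => ?_)
    have key {u v w : R} (hu : u ∈ I) (hv : v ∈ I) (hw : w ∈ I) :
        (a + u) * (b + v) * (c + w) = 0 :=
      h.add_mul_add_mul_add_eq_zero ha hb hc h0 hcon.1 hcon.2 hu hv hw
    have z := I.zero_mem
    have cube : x ^ 3 = 0 := by
      linear_combination key hx hx hx - key hx hx z - key hx z hx - key z hx hx
        + key hx z z + key z hx z + key z z hx - h0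
    exact eq_zero_of_pow_eq_zero cube
  · exact h.2 a b c ha hb hc h0 habc
end

section
/- Let R be a commutative local ring with identity and let I be a weakly 1-absorbing prime ideal of R that is not a 1-absorbing prime ideal. Then: (1) for every nilpotent element w of R, either w² ∈ I, or w²I = 0 and wI² = 0; (2) (√0)² I² = 0, where √0 is the nilradical of R. -/
/-- A triple of nonunits witnessing that `I` is not 1-absorbing prime, with zero product. -/
structure IsTripleZero {R : Type*} [CommRing R] (I : Ideal R) (a b c : R) : Prop where
  left : ¬IsUnit a
  middle : ¬IsUnit b
  right : ¬IsUnit c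
  mul_eq_zero : a * b * c = 0
  mul_notMem : a * b ∉ I
  notMem : c ∉ I

theorem IsWeakly1AbsorbingPrime.exists_isTripleZero {R : Type*} [CommRing R] {I : Ideal R}
    (hI : IsWeakly1AbsorbingPrime I) (hI' : ¬Is1AbsorbingPrime I) :
    ∃ a b c, IsTripleZero I a b c := by
  by_contra! h
  refine hI' ⟨hI.1, fun a b c ha hb hc habc => ?_⟩
  by_contra! hn
  by_cases h0 : a * b * c = 0
  · exact h a b c ⟨ha, hb, hc, h0, hn.1, hn.2⟩
  · exact (hI.2 a b c ha hb hc h0 habc).elim hn.1 hn.2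

namespace IsTripleZero

variable {R : Type*} [CommRing R] [IsLocalRing R] {I : Ideal R} {a b c x y z : R}

theorem add_mul_add_mul_add_eq_zero (h : IsTripleZero I a b c) (hI : IsWeakly1AbsorbingPrime I)
    (hx : x ∈ I) (hy : y ∈ I) (hz : z ∈ I) : (a + x) * (b + y) * (c + z) = 0 := by
  have nonunit_add {r s : R} (hr : ¬IsUnit r) (hs : s ∈ I) : ¬IsUnit (r + s) :=
    IsLocalRing.nonunits_add hr fun hu => hI.1 (I.eq_top_of_isUnit_mem hs hu)
  have hmem : a * y + x * (b + y) ∈ I :=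
    I.add_mem (I.mul_mem_left _ hy) (I.mul_mem_right _ hx)
  by_contra h0
  have hprod : (a + x) * (b + y) * (c + z) ∈ I := by
    have : (a + x) * (b + y) * (c + z) =
        (a * y + x * (b + y)) * c + (a + x) * (b + y) * z := by
      linear_combination h.mul_eq_zero
    rw [this]
    exact I.add_mem (I.mul_mem_right _ hmem) (I.mul_mem_left _ hz)
  rcases hI.2 _ _ _ (nonunit_add h.left hx) (nonunit_add h.middle hy) (nonunit_add h.right hz)
    h0 hprod with hab | hc
  · refine h.mul_notMem ((I.add_mem_iff_left hmem).1 ?_)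
    convert hab using 1
    ring
  · exact h.notMem ((I.add_mem_iff_left hz).1 hc)

theorem mul_mul_mem_eq_zero (h : IsTripleZero I a b c) (hI : IsWeakly1AbsorbingPrime I)
    (hz : z ∈ I) : a * b * z = 0 := by
  have := h.add_mul_add_mul_add_eq_zero hI I.zero_mem I.zero_mem hz
  linear_combination this - h.mul_eq_zero

theorem left_mul_mem_mul_mem_eq_zero (h : IsTripleZero I a b c)
    (hI : IsWeakly1AbsorbingPrime I) (hy : y ∈ I) (hz : z ∈ I) : a * y * z = 0 := by
  have h₁ := h.add_mul_add_mul_add_eq_zero hI I.zero_mem hy hz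
  have h₂ := h.add_mul_add_mul_add_eq_zero hI I.zero_mem hy I.zero_mem
  linear_combination h₁ - h₂ - h.mul_mul_mem_eq_zero hI hz

theorem mem_mul_mem_mul_mem_eq_zero (h : IsTripleZero I a b c)
    (hI : IsWeakly1AbsorbingPrime I) (hx : x ∈ I) (hy : y ∈ I) (hz : z ∈ I) :
    x * y * z = 0 := by
  have h₁ := h.add_mul_add_mul_add_eq_zero hI hx hy hz
  have h₂ := h.add_mul_add_mul_add_eq_zero hI hx hy I.zero_mem
  have h₃ := h.add_mul_add_mul_add_eq_zero hI hx I.zero_mem hz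
  have h₄ := h.add_mul_add_mul_add_eq_zero hI hx I.zero_mem I.zero_mem
  linear_combination h₁ - h₂ - h₃ + h₄ - h.left_mul_mem_mul_mem_eq_zero hI hy hz

end IsTripleZero

theorem IsWeakly1AbsorbingPrime.exists_isTripleZero_of_isNilpotent {R : Type*} [CommRing R]
    [IsLocalRing R] {I : Ideal R} (hI : IsWeakly1AbsorbingPrime I) {w : R}
    (hw : IsNilpotent w) (hw2 : w ^ 2 ∉ I) : ∃ c, IsTripleZero I w w c := by
  classical
  have hex : ∃ n, w ^ n ∈ I := by
    obtain ⟨n, hn⟩ := hw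
    exact ⟨n, hn ▸ I.zero_mem⟩
  obtain ⟨k, hk⟩ : ∃ k, Nat.find hex = k + 3 := by
    refine Nat.exists_eq_add_of_le' (not_lt.1 fun hlt => hw2 ?_)
    exact I.pow_mem_of_pow_mem (Nat.find_spec hex) (Nat.lt_succ_iff.1 hlt)
  have hmem : w ^ (k + 3) ∈ I := hk ▸ Nat.find_spec hex
  have hnot : w ^ (k + 1) ∉ I := Nat.find_min hex (by omega)
  have hpow : w * w * w ^ (k + 1) = w ^ (k + 3) := by ring
  have hnu : ¬IsUnit w := hw.not_isUnit
  have hnu' : ¬IsUnit (w ^ (k + 1)) := fun h => hnu ((isUnit_pow_succ_iff).1 h)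
  have hww : w * w ∉ I := by rwa [← pow_two]
  refine ⟨w ^ (k + 1), hnu, hnu, hnu', ?_, hww, hnot⟩
  by_contra h0
  exact (hI.2 _ _ _ hnu hnu hnu' h0 (hpow ▸ hmem)).elim hww hnot

theorem IsWeakly1AbsorbingPrime.nilpotent_mul_mul_mem_mul_mem_eq_zero {R : Type*} [CommRing R]
    [IsLocalRing R] {I : Ideal R} (hI : IsWeakly1AbsorbingPrime I)
    (hI' : ¬Is1AbsorbingPrime I) {u v x y : R} (hu : IsNilpotent u) (hv : IsNilpotent v)
    (hx : x ∈ I) (hy : y ∈ I) : u * v * (x * y) = 0 := by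
  by_cases hu2 : u ^ 2 ∈ I
  · by_cases huv : u * v ∈ I
    · obtain ⟨a, b, c, h⟩ := hI.exists_isTripleZero hI'
      linear_combination h.mem_mul_mem_mul_mem_eq_zero hI huv hx hy
    · have huI : u ∉ I := fun h => huv (I.mul_mem_right _ h)
      have h : IsTripleZero I u v u := by
        refine ⟨hu.not_isUnit, hv.not_isUnit, hu.not_isUnit, ?_, huv, huI⟩
        by_contra h0
        refine (hI.2 _ _ _ hu.not_isUnit hv.not_isUnit hu.not_isUnit h0 ?_).elim huv huI
        rw [show u * v * u = u ^ 2 * v by ring]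
        exact I.mul_mem_right _ hu2
      linear_combination y * h.mul_mul_mem_eq_zero hI hx
  · obtain ⟨c, h⟩ := hI.exists_isTripleZero_of_isNilpotent hu hu2
    linear_combination v * h.left_mul_mem_mul_mem_eq_zero hI hx hy

/-- If `I` is a weakly 1-absorbing prime ideal of a local ring `R` that is not 1-absorbing
prime, then (1) for every nilpotent `w`, either `w² ∈ I` or `w²I = wI² = 0`, and
(2) `(√0)²I² = 0`. -/
theorem statement5 {R : Type*} [CommRing R] [IsLocalRing R] (I : Ideal R)
    (hI : IsWeakly1AbsorbingPrime I) (hI' : ¬Is1AbsorbingPrime I) :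
    (∀ w : R, IsNilpotent w →
      w ^ 2 ∈ I ∨ ((∀ x ∈ I, w ^ 2 * x = 0) ∧ ∀ x ∈ I, ∀ y ∈ I, w * x * y = 0)) ∧
    nilradical R ^ 2 * I ^ 2 = ⊥ := by
  refine ⟨fun w hw => or_iff_not_imp_left.2 fun hw2 => ?_, ?_⟩
  · obtain ⟨c, h⟩ := hI.exists_isTripleZero_of_isNilpotent hw hw2
    exact ⟨fun x hx => by rw [pow_two, h.mul_mul_mem_eq_zero hI hx],
      fun x hx y hy => h.left_mul_mem_mul_mem_eq_zero hI hx hy⟩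
  · rw [pow_two, pow_two, eq_bot_iff, Ideal.mul_le]
    intro r hr s hs
    rw [Ideal.mem_bot]
    induction hr using Submodule.mul_induction_on' with
    | mem_mul_mem u hu v hv =>
      induction hs using Submodule.mul_induction_on' with
      | mem_mul_mem x hx y hy =>
        exact hI.nilpotent_mul_mul_mem_mul_mem_eq_zero hI' hu hv hx hy
      | add x _ y _ hx hy => rw [mul_add, hx, hy, add_zero]
    | add u _ v _ hu hv => rw [add_mul, hu, hv, add_zero]
end

section
/- Let R be a commutative ring with identity and let I be a proper ideal of R such that √0 ⊆ I and the nilradical √0 is a prime ideal of R. Then I is a weakly 1-absorbing prime ideal of R if and only if I is a 1-absorbing prime ideal of R. -/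
/-- Let `I` be a proper ideal of `R` with `√0 ⊆ I` and `√0` prime. Then `I` is weakly
1-absorbing prime iff `I` is 1-absorbing prime. -/
theorem statement6 {R : Type*} [CommRing R] (I : Ideal R) (hItop : I ≠ ⊤)
    (hnil : nilradical R ≤ I) (hprime : (nilradical R).IsPrime) :
    IsWeakly1AbsorbingPrime I ↔ Is1AbsorbingPrime I := by
  refine ⟨fun h => ⟨hItop, fun a b c ha hb hc habc => ?_⟩,
    fun h => ⟨hItop, fun a b c ha hb hc _ habc => h.2 a b c ha hb hc habc⟩⟩
  by_cases h0 : a * b * c = 0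
  · have hmem : a * b * c ∈ nilradical R := h0 ▸ zero_mem _
    exact (hprime.mem_or_mem hmem).imp (fun hab => hnil hab) (fun hc => hnil hc)
  · exact h.2 a b c ha hb hc h0 habc
end

section
/- Let R be a reduced commutative ring with identity and let I be a nonzero weakly 1-absorbing prime ideal of R. Then the radical √I is a prime ideal of R. -/
/-- In a reduced ring, the radical of a weakly 1-absorbing prime ideal is weakly prime. -/
theorem IsWeakly1AbsorbingPrime.isWeaklyPrime_radical {R : Type*} [CommRing R] [IsReduced R]
    {I : Ideal R} (hI : IsWeakly1AbsorbingPrime I) : IsWeaklyPrime I.radical := by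
  refine ⟨fun h => hI.1 (Ideal.radical_eq_top.mp h), fun x y hne hmem => ?_⟩
  by_cases hx : IsUnit x
  · exact Or.inr ((Ideal.unit_mul_mem_iff_mem _ hx).mp hmem)
  by_cases hy : IsUnit y
  · exact Or.inl ((Ideal.mul_unit_mem_iff_mem _ hy).mp hmem)
  obtain ⟨n, hn⟩ := hmem
  have hn0 : n ≠ 0 := by
    rintro rfl
    exact hI.1 ((Ideal.eq_top_iff_one I).mpr (by simpa using hn))
  rw [mul_pow] at hn
  have hne' : x ^ n * x ^ n * y ^ n ≠ 0 := fun h => by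
    have h2 : (x * y) ^ (n + n) = 0 := by
      rw [mul_pow, pow_add, pow_add, ← mul_assoc, h, zero_mul]
    exact hne (eq_zero_of_pow_eq_zero h2)
  have hmem' : x ^ n * x ^ n * y ^ n ∈ I := by
    rw [mul_assoc]
    exact I.mul_mem_left _ hn
  rcases hI.2 _ _ _ (mt (isUnit_pow_iff hn0).mp hx) (mt (isUnit_pow_iff hn0).mp hx)
    (mt (isUnit_pow_iff hn0).mp hy) hne' hmem' with h | h
  · exact Or.inl ⟨n + n, by rwa [pow_add]⟩
  · exact Or.inr ⟨n, h⟩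

/-- In a reduced ring, a weakly prime ideal which is nonzero is prime. -/
theorem IsWeaklyPrime.isPrime {R : Type*} [CommRing R] [IsReduced R] {P : Ideal R}
    (hP : IsWeaklyPrime P) (hP0 : P ≠ ⊥) : P.IsPrime := by
  refine ⟨hP.1, fun {x y} hxy => ?_⟩
  by_cases h0 : x * y = 0
  swap
  · exact hP.2 x y h0 hxy
  obtain ⟨i, hi, hi0⟩ := Submodule.exists_mem_ne_zero_of_ne_bot hP0
  by_cases hxi : x * i = 0
  · by_cases hyi : y * i = 0
    · have h : (x + i) * (y + i) = i * i := by linear_combination h0 + hxi + hyi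
      have hii : i * i ≠ 0 := fun h => hi0 (eq_zero_of_pow_eq_zero ((pow_two i).trans h))
      exact (hP.2 (x + i) (y + i) (h ▸ hii) (h ▸ P.mul_mem_left i hi)).imp
        (P.add_mem_iff_left hi).mp (P.add_mem_iff_left hi).mp
    · have h : (x + i) * y = y * i := by linear_combination h0
      exact (hP.2 (x + i) y (h ▸ hyi) (h ▸ P.mul_mem_left y hi)).imp_left
        (P.add_mem_iff_left hi).mp
  · have h : x * (y + i) = x * i := by linear_combination h0
    exact (hP.2 x (y + i) (h ▸ hxi) (h ▸ P.mul_mem_left x hi)).imp_right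
      (P.add_mem_iff_left hi).mp

/-- If `R` is a reduced ring and `I` is a nonzero weakly 1-absorbing prime ideal of `R`,
then `√I` is a prime ideal of `R`. -/
theorem statement7 {R : Type*} [CommRing R] [IsReduced R] (I : Ideal R)
    (hI0 : I ≠ ⊥) (hI : IsWeakly1AbsorbingPrime I) :
    I.radical.IsPrime := by
  exact hI.isWeaklyPrime_radical.isPrime fun h =>
    hI0 (le_bot_iff.mp (h ▸ Ideal.le_radical))
end

section
/- Let R be a commutative ring with identity that is not local, and let I be a proper ideal of R such that for every element x ∈ I, the annihilator ann(x) = {r ∈ R : rx = 0} is not a maximal ideal of R. Then I is a weakly 1-absorbing prime ideal of R if and only if I is a weakly prime ideal of R. -/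
theorem IsWeaklyPrime.isWeakly1AbsorbingPrime {R : Type*} [CommRing R] {I : Ideal R}
    (h : IsWeaklyPrime I) : IsWeakly1AbsorbingPrime I :=
  ⟨h.1, fun a b c _ _ _ h0 hI ↦ h.2 (a * b) c h0 hI⟩

/-- In a non-local ring, every maximal ideal misses some nonunit. -/
theorem Ideal.IsMaximal.exists_notMem_not_isUnit {R : Type*} [CommRing R]
    (hR : ¬IsLocalRing R) {M : Ideal R} (hM : M.IsMaximal) :
    ∃ d, d ∉ M ∧ ¬IsUnit d := by
  by_contra! H
  refine hR (IsLocalRing.of_unique_max_ideal ⟨M, hM, fun N hN ↦ ?_⟩)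
  refine hN.eq_of_le hM.ne_top fun x hx ↦ ?_
  by_contra hxM
  exact hN.ne_top (N.eq_top_of_isUnit_mem hx (H x hxM))

/-- In a non-local ring, if `A` is a proper non-maximal ideal, then any ideal containing all
nonunits outside `A` is the whole ring. -/
theorem Ideal.eq_top_of_nonunits_diff_subset {R : Type*} [CommRing R] (hR : ¬IsLocalRing R)
    {A K : Ideal R} (hA : A ≠ ⊤) (hAmax : ¬A.IsMaximal)
    (hK : ∀ c, ¬IsUnit c → c ∉ A → c ∈ K) : K = ⊤ := by
  obtain ⟨M, hM, hAM⟩ := A.exists_le_maximal hA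
  have hnu : ∀ x ∈ M, ¬IsUnit x := fun x hx hu ↦ hM.ne_top (M.eq_top_of_isUnit_mem hx hu)
  obtain ⟨c, hcM, hcA⟩ := Set.not_subset.1 fun hMA : (M : Set R) ⊆ A ↦
    hAmax (le_antisymm hAM hMA ▸ hM)
  have hcK : c ∈ K := hK c (hnu c hcM) hcA
  have hMK : M ≤ K := fun m hm ↦ by
    by_cases hmA : m ∈ A
    · have hmc : m + c ∈ K := hK _ (hnu _ (M.add_mem hm hcM)) fun h ↦
        hcA ((A.add_mem_iff_right hmA).1 h)
      exact (K.add_mem_iff_left hcK).1 hmc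
    · exact hK m (hnu m hm) hmA
  obtain ⟨d, hdM, hd⟩ := hM.exists_notMem_not_isUnit hR
  have hdK : d ∈ K := hK d hd fun h ↦ hdM (hAM h)
  by_contra hKtop
  exact hdM (hM.eq_of_le hKtop hMK ▸ hdK)

theorem IsWeakly1AbsorbingPrime.mem_or_mem {R : Type*} [CommRing R] {I : Ideal R}
    (h : IsWeakly1AbsorbingPrime I) (hR : ¬IsLocalRing R) {a b : R} (hab : a * b ≠ 0)
    (habI : a * b ∈ I) (hann : ¬((⊥ : Ideal R).colon (Ideal.span {a * b})).IsMaximal) :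
    a ∈ I ∨ b ∈ I := by
  by_cases ha : IsUnit a
  · exact .inr ((I.unit_mul_mem_iff_mem ha).1 habI)
  by_cases hb : IsUnit b
  · exact .inl ((I.mul_unit_mem_iff_mem hb).1 habI)
  refine or_iff_not_imp_right.2 fun hbI ↦ ?_
  have hmem (r : R) : r ∈ (⊥ : Ideal R).colon (Ideal.span {a * b}) ↔ r * (a * b) = 0 := by
    simp
  have htop : I.colon {a} = ⊤ := by
    refine Ideal.eq_top_of_nonunits_diff_subset hR (fun h1 ↦ hab ?_) hann fun c hc hcA ↦ ?_
    · simpa using (hmem 1).1 (h1 ▸ Submodule.mem_top)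
    · rw [hmem, ← mul_assoc] at hcA
      have hI : c * a * b ∈ I := mul_assoc c a b ▸ I.mul_mem_left c habI
      simpa [Submodule.mem_colon] using (h.2 c a b hc ha hb hcA hI).resolve_right hbI
  simpa [Submodule.mem_colon] using (I.colon {a}).eq_top_iff_one.1 htop

/-- Let `R` be a non-local ring and `I` a proper ideal of `R` such that `ann(x)` is not a
maximal ideal of `R` for every `x ∈ I`. Then `I` is weakly 1-absorbing prime iff `I` is
weakly prime. -/
theorem statement8 {R : Type*} [CommRing R] (hR : ¬IsLocalRing R) (I : Ideal R)
    (hItop : I ≠ ⊤)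
    (hann : ∀ x ∈ I, ¬((⊥ : Ideal R).colon (Ideal.span {x})).IsMaximal) :
    IsWeakly1AbsorbingPrime I ↔ IsWeaklyPrime I := by
  refine ⟨fun h ↦ ⟨hItop, fun a b hab habI ↦ ?_⟩, IsWeaklyPrime.isWeakly1AbsorbingPrime⟩
  exact h.mem_or_mem hR hab habI (hann _ habI)
end

section
/- Let R be a Dedekind domain that is not a field and let I be a nonzero weakly 1-absorbing prime ideal of R. Then I = M or I = M² for some maximal ideal M of R. -/
theorem IsWeakly1AbsorbingPrime.is1AbsorbingPrime {R : Type*} [CommRing R] [IsDomain R]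
    {I : Ideal R} (hI : IsWeakly1AbsorbingPrime I) : Is1AbsorbingPrime I := by
  refine ⟨hI.1, fun a b c ha hb hc h => ?_⟩
  by_cases h0 : a * b * c = 0
  · rcases mul_eq_zero.mp h0 with h1 | h1 <;> simp [h1]
  · exact hI.2 a b c ha hb hc h0 h

theorem Is1AbsorbingPrime.isPrime_radical {R : Type*} [CommRing R] {I : Ideal R}
    (hI : Is1AbsorbingPrime I) : I.radical.IsPrime := by
  refine ⟨mt Ideal.radical_eq_top.mp hI.1, fun {a b} h => ?_⟩
  by_cases ha : IsUnit a
  · exact Or.inr ((Ideal.unit_mul_mem_iff_mem _ ha).mp h)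
  by_cases hb : IsUnit b
  · exact Or.inl ((Ideal.mul_unit_mem_iff_mem _ hb).mp h)
  obtain ⟨n, hn⟩ := h
  have hn0 : n ≠ 0 := by
    rintro rfl
    exact hI.1 ((Ideal.eq_top_iff_one I).mpr (by simpa using hn))
  have hpow {x : R} (hx : ¬IsUnit x) : ¬IsUnit (x ^ n) := by rwa [isUnit_pow_iff hn0]
  have hmem : a ^ n * a ^ n * b ^ (2 * n) ∈ I := by
    have h2 := I.mul_mem_left ((a * b) ^ n) hn
    convert h2 using 1
    ring
  have hb' : ¬IsUnit (b ^ (2 * n)) := by rwa [isUnit_pow_iff (by omega)]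
  rcases hI.2 _ _ _ (hpow ha) (hpow ha) hb' hmem with h | h
  · exact Or.inl ⟨n + n, by rwa [pow_add]⟩
  · exact Or.inr ⟨2 * n, h⟩

theorem Is1AbsorbingPrime.sq_le_of_pow_le {R : Type*} [CommRing R] {I M : Ideal R}
    (hI : Is1AbsorbingPrime I) (hM : M ≠ ⊤) (n : ℕ) (h : M ^ (n + 2) ≤ I) : M ^ 2 ≤ I := by
  induction n with
  | zero => simpa using h
  | succ k ih =>
    have nonunit {x : R} (hx : x ∈ M) : ¬IsUnit x := fun hu =>
      hM (Ideal.eq_top_of_isUnit_mem M hx hu)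
    by_cases hle : M ^ (k + 1) ≤ I
    · exact ih ((Ideal.pow_le_pow_right (Nat.le_succ _)).trans hle)
    obtain ⟨c, hc, hcI⟩ := SetLike.not_le_iff_exists.mp hle
    rw [pow_two, Ideal.mul_le]
    intro a ha b hb
    refine (hI.2 a b c (nonunit ha) (nonunit hb)
      (nonunit (Ideal.pow_le_self k.succ_ne_zero hc)) (h ?_)).resolve_right hcI
    rw [show k + 1 + 2 = 1 + 1 + (k + 1) by omega, pow_add, pow_add, pow_one]
    exact Ideal.mul_mem_mul (Ideal.mul_mem_mul ha hb) hc

/-- If `R` is a Dedekind domain that is not a field and `I` is a nonzero weakly 1-absorbing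
prime ideal of `R`, then `I = M` or `I = M²` for some maximal ideal `M` of `R`. -/
theorem statement9 {R : Type*} [CommRing R] [IsDedekindDomain R] (hR : ¬IsField R)
    (I : Ideal R) (hI0 : I ≠ ⊥) (hI : IsWeakly1AbsorbingPrime I) :
    ∃ M : Ideal R, M.IsMaximal ∧ (I = M ∨ I = M ^ 2) := by
  have hI' := hI.is1AbsorbingPrime
  have hprime := hI'.isPrime_radical
  have hM0 : I.radical ≠ ⊥ := fun h => hI0 (eq_bot_iff.mpr (h ▸ Ideal.le_radical))
  have hM : I.radical.IsMaximal := hprime.isMaximal hM0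
  refine ⟨I.radical, hM, ?_⟩
  obtain ⟨n, hn⟩ := I.exists_radical_pow_le_of_fg (IsNoetherian.noetherian _)
  have hsq : I.radical ^ 2 ≤ I := hI'.sq_le_of_pow_le hM.ne_top n
    ((Ideal.pow_le_pow_right (Nat.le_add_right n 2)).trans hn)
  obtain ⟨i, hi, h⟩ := (dvd_prime_pow (Ideal.prime_of_isPrime hM0 hprime) 2).mp
    (Ideal.dvd_iff_le.mpr hsq)
  rw [associated_iff_eq] at h
  interval_cases i
  · exact absurd (by simpa using h) hI.1
  · exact Or.inl (by simpa using h)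
  · exact Or.inr h
end

section
/- Let R be a principal ideal domain that is not a field and let I be a nonzero proper ideal of R. If I is a weakly 1-absorbing prime ideal of R, then I = pR or I = p²R for some nonzero prime element p of R. -/
/-- Let `R` be a principal ideal domain that is not a field and `I` a nonzero proper ideal
of `R`. If `I` is weakly 1-absorbing prime, then `I = pR` or `I = p²R` for some nonzero
prime element `p` of `R`. -/
theorem statement10 {R : Type*} [CommRing R] [IsDomain R] [IsPrincipalIdealRing R]
    (hR : ¬IsField R) (I : Ideal R) (hI0 : I ≠ ⊥) (hItop : I ≠ ⊤)
    (hI : IsWeakly1AbsorbingPrime I) :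
    ∃ p : R, p ≠ 0 ∧ Prime p ∧ (I = Ideal.span {p} ∨ I = Ideal.span {p ^ 2}) := by
  obtain ⟨a, rfl⟩ := IsPrincipalIdealRing.principal I
  rw [Ideal.submodule_span_eq] at hI0 hItop hI ⊢
  have ha0 : a ≠ 0 := by simpa using hI0
  have hau : ¬IsUnit a := by rwa [Ne, Ideal.span_singleton_eq_top] at hItop
  have hI' := hI.2
  simp only [Ideal.mem_span_singleton] at hI'
  obtain ⟨p, hp, b, rfl⟩ := WfDvdMonoid.exists_irreducible_factor hau ha0
  refine ⟨p, hp.ne_zero, hp.prime, ?_⟩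
  have hb0 : b ≠ 0 := right_ne_zero_of_mul ha0
  by_cases hbu : IsUnit b
  · exact .inl (Ideal.span_singleton_mul_right_unit hbu p)
  right
  obtain ⟨q, hq, c, rfl⟩ := WfDvdMonoid.exists_irreducible_factor hbu hb0
  have hc0 : c ≠ 0 := right_ne_zero_of_mul hb0
  have hc : IsUnit c := by
    by_contra hcu
    rcases hI' p q c hp.not_isUnit hq.not_isUnit hcu (by rwa [mul_assoc])
      (by rw [mul_assoc]) with h | h
    · rw [← mul_assoc] at h
      exact hcu (isUnit_of_dvd_one ((mul_dvd_mul_iff_left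
        (mul_ne_zero hp.ne_zero hq.ne_zero)).1 (by simpa using h)))
    · rw [← mul_assoc] at h
      exact hp.not_isUnit (isUnit_of_mul_isUnit_left (isUnit_of_dvd_one
        ((mul_dvd_mul_iff_right hc0).1 (by simpa using h))))
  rw [← mul_assoc, Ideal.span_singleton_mul_right_unit hc]
  have hdvd : p * (q * c) ∣ p * q := by
    rw [← mul_assoc]
    exact (hc.mul_right_dvd).2 dvd_rfl
  have hqp : q ∣ p := by
    rcases hI' p p q hp.not_isUnit hp.not_isUnit hq.not_isUnit
      (mul_ne_zero (mul_ne_zero hp.ne_zero hp.ne_zero) hq.ne_zero)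
      (hdvd.trans ⟨p, by ring⟩) with h | h
    · exact (dvd_mul_right q c).trans ((mul_dvd_mul_iff_left hp.ne_zero).1 h)
    · have hpq : p * q ∣ q := (mul_dvd_mul_left p (dvd_mul_right q c)).trans h
      exact absurd (isUnit_of_dvd_one ((mul_dvd_mul_iff_right hq.ne_zero).1
        (by simpa using hpq))) hp.not_isUnit
  rw [pow_two, Ideal.span_singleton_eq_span_singleton]
  exact (hq.associated_of_dvd hp hqp).mul_left p
end

section
/- Let R be a commutative local ring with identity with unique maximal ideal M such that M² = 0. Then every proper ideal of R is a 1-absorbing prime ideal of R. -/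
/-- Let `R` be a local ring with maximal ideal `M` such that `M² = 0`. Then every proper
ideal of `R` is a 1-absorbing prime ideal of `R`. -/
theorem statement18 {R : Type*} [CommRing R] [IsLocalRing R]
    (hM : (IsLocalRing.maximalIdeal R) ^ 2 = ⊥) :
    ∀ I : Ideal R, I ≠ ⊤ → Is1AbsorbingPrime I := by
  intro I hI
  refine ⟨hI, fun a b c ha hb _ _ => Or.inl ?_⟩
  have hab : a * b ∈ IsLocalRing.maximalIdeal R ^ 2 := by
    rw [pow_two]
    exact Ideal.mul_mem_mul ha hb
  rw [hM, Ideal.mem_bot] at hab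
  exact hab ▸ I.zero_mem
end

section
/- Let R₁ and R₂ be commutative local rings with identity, with unique maximal ideals M₁ and M₂ respectively, and let R = R₁ × R₂. If every proper ideal of R is a weakly 1-absorbing prime ideal of R, then M₁² = 0, M₂² = 0, and either R₁ is a field or R₂ is a field. -/
/-- If every proper ideal is weakly 1-absorbing prime, then for a nonunit idempotent `e` and a
nonunit `c` with `e * c ≠ 0`, the product `e * c` divides one of its factors. -/
theorem mul_dvd_or_mul_dvd_of_isIdempotentElem {R : Type*} [CommRing R]
    (h : ∀ I : Ideal R, I ≠ ⊤ → IsWeakly1AbsorbingPrime I) {e c : R}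
    (he : IsIdempotentElem e) (hue : ¬IsUnit e) (huc : ¬IsUnit c) (hec : e * c ≠ 0) :
    e * c ∣ e ∨ e * c ∣ c := by
  have hproper : Ideal.span {e * c} ≠ ⊤ := fun H =>
    hue (isUnit_of_mul_isUnit_left (Ideal.span_singleton_eq_top.mp H))
  have key := (h _ hproper).2 e e c hue hue huc
  rw [he.eq] at key
  simpa only [Ideal.mem_span_singleton] using key hec (Ideal.mem_span_singleton_self _)

/-- If every proper ideal of `R × S` is weakly 1-absorbing prime, then every nonunit of `R`
is zero. -/
theorem eq_zero_of_not_isUnit_fst {R S : Type*} [CommRing R] [CommRing S] [Nontrivial S]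
    (h : ∀ I : Ideal (R × S), I ≠ ⊤ → IsWeakly1AbsorbingPrime I) {x : R} (hx : ¬IsUnit x) :
    x = 0 := by
  by_contra hx0
  rcases mul_dvd_or_mul_dvd_of_isIdempotentElem h (e := (1, 0)) (c := (x, 1))
    (by simp [IsIdempotentElem]) (by simp [Prod.isUnit_iff]) (by simp [Prod.isUnit_iff, hx])
    (by simp [hx0]) with ⟨d, hd⟩ | ⟨d, hd⟩
  · exact hx (IsUnit.of_mul_eq_one d.1 (by simpa using (congrArg Prod.fst hd).symm))
  · simpa using congrArg Prod.snd hd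

/-- If every proper ideal of `R × S` is weakly 1-absorbing prime, then every nonunit of `S`
is zero. -/
theorem eq_zero_of_not_isUnit_snd {R S : Type*} [CommRing R] [CommRing S] [Nontrivial R]
    (h : ∀ I : Ideal (R × S), I ≠ ⊤ → IsWeakly1AbsorbingPrime I) {y : S} (hy : ¬IsUnit y) :
    y = 0 := by
  by_contra hy0
  rcases mul_dvd_or_mul_dvd_of_isIdempotentElem h (e := (0, 1)) (c := (1, y))
    (by simp [IsIdempotentElem]) (by simp [Prod.isUnit_iff]) (by simp [Prod.isUnit_iff, hy])
    (by simp [hy0]) with ⟨d, hd⟩ | ⟨d, hd⟩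
  · exact hy (IsUnit.of_mul_eq_one d.2 (by simpa using (congrArg Prod.snd hd).symm))
  · simpa using congrArg Prod.fst hd

/-- Let `R₁, R₂` be local rings with maximal ideals `M₁, M₂`, and `R = R₁ × R₂`. If every
proper ideal of `R` is weakly 1-absorbing prime, then `M₁² = 0`, `M₂² = 0`, and either
`R₁` or `R₂` is a field. -/
theorem statement19 {R₁ R₂ : Type*} [CommRing R₁] [CommRing R₂]
    [IsLocalRing R₁] [IsLocalRing R₂]
    (h : ∀ I : Ideal (R₁ × R₂), I ≠ ⊤ → IsWeakly1AbsorbingPrime I) :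
    (IsLocalRing.maximalIdeal R₁) ^ 2 = ⊥ ∧ (IsLocalRing.maximalIdeal R₂) ^ 2 = ⊥ ∧
      (IsField R₁ ∨ IsField R₂) := by
  have h₁ : IsLocalRing.maximalIdeal R₁ = ⊥ :=
    (Submodule.eq_bot_iff _).mpr fun _ hx => eq_zero_of_not_isUnit_fst h hx
  have h₂ : IsLocalRing.maximalIdeal R₂ = ⊥ :=
    (Submodule.eq_bot_iff _).mpr fun _ hy => eq_zero_of_not_isUnit_snd h hy
  exact ⟨by simp [h₁], by simp [h₂], Or.inl (IsLocalRing.isField_iff_maximalIdeal_eq.mpr h₁)⟩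
end
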